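/- Let V be a finite vertex set with class labels z : V → {1,…,c}, let p_1, …, p_c ∈ H with ‖p_j‖ ≤ P, and for each u ∈ V let r_u, h_u^{(1)}, h_u^{(2)} ∈ H with ‖h_u^{(1)}‖ ≤ B and ‖h_u^{(2)}‖ ≤ B. Define w_u = Σ_{j=1}^{c} α^{class}_{u,j} p_j with α^{class}_{u,j} = exp(β_c ⟨r_u, p_j⟩)/Σ_{k=1}^{c} exp(β_c ⟨r_u, p_k⟩); define hop weights α_{u,k} = exp(β_h ⟨h_u^{(k)}, w_u⟩)/(exp(β_h ⟨h_u^{(1)}, w_u⟩) + exp(β_h ⟨h_u^{(2)}, w_u⟩)) for k ∈ {1,2}, and set h_u = α_{u,1} h_u^{(1)} + α_{u,2} h_u^{(2)}. Assume for every u ∈ V: (i) ⟨r_u, p_{z_u}⟩ ≥ ⟨r_u, p_j⟩ + γ for all j ≠ z_u; (ii) ⟨h_u^{(2)}, p_{z_u}⟩ ≥ ⟨h_u^{(1)}, p_{z_u}⟩ + η; (iii) Φ_u(h^{(2)}) ≥ δ, and that S_u, D_u are nonempty. If 4BP(c − 1) e^{−β_c γ} ≤ η/2 and 8B² e^{−β_h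 η/2} < δ, then Φ_u(h) > 0 for every u ∈ V. -/

import Mathlib

open Finset
open scoped RealInnerProductSpace

/-- Softmax weights with temperature `β` on a score vector `s : Fin c → ℝ`. -/
noncomputable def softmax {c : ℕ} (β : ℝ) (s : Fin c → ℝ) (j : Fin c) : ℝ :=
  Real.exp (β * s j) / ∑ k, Real.exp (β * s k)

/-- The HND gap of node `u` under embedding `h`:
`Φ_u(h) = (1/|S_u|) Σ_{v ∈ S_u} ⟨h_u, h_v⟩ − (1/|D_u|) Σ_{v ∈ D_u} ⟨h_u, h_v⟩`,
where `S_u = {v ≠ u : z_v = z_u}` and `D_u = {v : z_v ≠ z_u}`. -/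
noncomputable def HNDgap {V H : Type*} [Fintype V] [DecidableEq V]
    [NormedAddCommGroup H] [InnerProductSpace ℝ H] {c : ℕ}
    (z : V → Fin c) (h : V → H) (u : V) : ℝ :=
  (1 / ((Finset.univ.filter fun v => v ≠ u ∧ z v = z u).card : ℝ)) *
      ∑ v ∈ Finset.univ.filter (fun v => v ≠ u ∧ z v = z u), ⟪h u, h v⟫
    - (1 / ((Finset.univ.filter fun v => z v ≠ z u).card : ℝ)) *
      ∑ v ∈ Finset.univ.filter (fun v => z v ≠ z u), ⟪h u, h v⟫

lemma softmax_nonneg {c : ℕ} (β : ℝ) (s : Fin c → ℝ) (j : Fin c) : 0 ≤ softmax β s j := by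
  unfold softmax; positivity

lemma sum_softmax {c : ℕ} (β : ℝ) (s : Fin c → ℝ) (i : Fin c) : ∑ j, softmax β s j = 1 := by
  have : 0 < ∑ k, Real.exp (β * s k) := Finset.sum_pos (fun _ _ => Real.exp_pos _) ⟨i, mem_univ i⟩
  simp only [softmax, ← Finset.sum_div]
  exact div_self this.ne'

lemma softmax_le_exp_of_margin {c : ℕ} {β γ : ℝ} (hβ : 0 ≤ β) {s : Fin c → ℝ} {i j : Fin c}
    (hs : s j + γ ≤ s i) : softmax β s j ≤ Real.exp (-(β * γ)) := by
  have hpos : 0 < ∑ k, Real.exp (β * s k) :=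
    Finset.sum_pos (fun _ _ => Real.exp_pos _) ⟨i, mem_univ i⟩
  rw [softmax, div_le_iff₀ hpos]
  calc Real.exp (β * s j) ≤ Real.exp (-(β * γ)) * Real.exp (β * s i) := by
        rw [← Real.exp_add, Real.exp_le_exp]
        nlinarith [mul_le_mul_of_nonneg_left hs hβ]
    _ ≤ _ := by
        gcongr
        exact Finset.single_le_sum (f := fun k => Real.exp (β * s k))
          (fun _ _ => (Real.exp_pos _).le) (mem_univ i)

/-- A softmax-weighted average of bounded vectors is exponentially close to the vector whose
score dominates with margin `γ`. -/
lemma norm_sum_softmax_smul_sub_le {H : Type*} [NormedAddCommGroup H] [NormedSpace ℝ H] {c : ℕ}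
    {β γ P : ℝ} (hβ : 0 ≤ β) {s : Fin c → ℝ} {p : Fin c → H} {i : Fin c}
    (hp : ∀ j, ‖p j‖ ≤ P) (hs : ∀ j, j ≠ i → s j + γ ≤ s i) :
    ‖∑ j, softmax β s j • p j - p i‖ ≤ 2 * P * ((c : ℝ) - 1) * Real.exp (-(β * γ)) := by
  have hP : 0 ≤ P := (norm_nonneg _).trans (hp i)
  have hsum : ∑ j, softmax β s j • p j - p i
      = ∑ j ∈ univ.erase i, softmax β s j • (p j - p i) := by
    rw [Finset.sum_erase _ (by simp)]
    simp only [smul_sub, Finset.sum_sub_distrib, ← Finset.sum_smul, sum_softmax β s i, one_smul]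
  have hterm : ∀ j ∈ univ.erase i,
      ‖softmax β s j • (p j - p i)‖ ≤ Real.exp (-(β * γ)) * (2 * P) := fun j hj => by
    rw [norm_smul, Real.norm_of_nonneg (softmax_nonneg β s j)]
    refine mul_le_mul (softmax_le_exp_of_margin hβ (hs j (ne_of_mem_erase hj))) ?_
      (norm_nonneg _) (Real.exp_pos _).le
    linarith [norm_sub_le (p j) (p i), hp i, hp j]
  have hcard : ((univ.erase i).card : ℝ) = (c : ℝ) - 1 := by
    rw [Finset.cast_card_erase_of_mem (mem_univ i)]
    simp
  rw [hsum]
  refine (norm_sum_le_of_le _ hterm).trans (le_of_eq ?_)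
  rw [Finset.sum_const, nsmul_eq_mul, hcard]
  ring

lemma abs_inner_sub_inner_le {H : Type*} [NormedAddCommGroup H] [InnerProductSpace ℝ H]
    {B ε : ℝ} {x x' y y' : H} (hx : ‖x‖ ≤ B) (hy' : ‖y'‖ ≤ B)
    (hxx : ‖x - x'‖ ≤ ε) (hyy : ‖y - y'‖ ≤ ε) :
    |⟪x, y⟫ - ⟪x', y'⟫| ≤ 2 * B * ε := by
  have hB : 0 ≤ B := (norm_nonneg _).trans hx
  have hε : 0 ≤ ε := (norm_nonneg _).trans hxx
  have heq : ⟪x, y⟫ - ⟪x', y'⟫ = ⟪x, y - y'⟫ + ⟪x - x', y'⟫ := by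
    rw [inner_sub_right, inner_sub_left]; ring
  rw [heq]
  have h₁ := (abs_real_inner_le_norm x (y - y')).trans (mul_le_mul hx hyy (norm_nonneg _) hB)
  have h₂ := (abs_real_inner_le_norm (x - x') y').trans (mul_le_mul hxx hy' (norm_nonneg _) hε)
  linarith [abs_add_le ⟪x, y - y'⟫ ⟪x - x', y'⟫]

lemma abs_average_sub_average_le {ι : Type*} {s : Finset ι} (hs : s.Nonempty) {f g : ι → ℝ}
    {ε : ℝ} (hfg : ∀ i, |f i - g i| ≤ ε) :
    |1 / (s.card : ℝ) * ∑ i ∈ s, f i - 1 / (s.card : ℝ) * ∑ i ∈ s, g i| ≤ ε := by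
  have hc : (0 : ℝ) < s.card := by exact_mod_cast hs.card_pos
  rw [← mul_sub, ← Finset.sum_sub_distrib, abs_mul, abs_of_nonneg (by positivity),
    one_div, inv_mul_le_iff₀ hc, ← nsmul_eq_mul]
  exact (Finset.abs_sum_le_sum_abs _ _).trans (Finset.sum_le_card_nsmul _ _ _ fun i _ => hfg i)

lemma HNDgap_sub_le {V H : Type*} [Fintype V] [DecidableEq V]
    [NormedAddCommGroup H] [InnerProductSpace ℝ H] {c : ℕ} {z : V → Fin c} {h h' : V → H}
    {u : V} {ε : ℝ}
    (hS : (Finset.univ.filter fun v => v ≠ u ∧ z v = z u).Nonempty)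
    (hD : (Finset.univ.filter fun v => z v ≠ z u).Nonempty)
    (hε : ∀ v, |⟪h u, h v⟫ - ⟪h' u, h' v⟫| ≤ ε) :
    HNDgap z h' u - 2 * ε ≤ HNDgap z h u := by
  have h₁ := (abs_le.mp (abs_average_sub_average_le hS hε)).1
  have h₂ := (abs_le.mp (abs_average_sub_average_le hD hε)).2
  unfold HNDgap
  linarith

lemma exp_div_add_exp_le {a b : ℝ} :
    Real.exp a / (Real.exp a + Real.exp b) ≤ Real.exp (a - b) := by
  rw [Real.exp_sub]
  have := Real.exp_pos a
  have := Real.exp_pos b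
  gcongr
  linarith

/-- Distance-aware hop separation suppresses similarity flip: under class margins,
hop margins, an informative-hop gap, and sufficiently large temperatures, the
prototype-gated hop fusion has strictly positive HND gap at every node. -/
theorem distance_aware_hop_selection_HND {V H : Type*} [Fintype V] [DecidableEq V]
    [NormedAddCommGroup H] [InnerProductSpace ℝ H] {c : ℕ}
    (z : V → Fin c) (p : Fin c → H) (r h1 h2 : V → H)
    (P B βc βh γ η δ : ℝ) (hc : 2 ≤ c)
    (hP : 0 < P) (hB : 0 < B) (hβc : 0 < βc) (hβh : 0 < βh)
    (hγ : 0 < γ) (hη : 0 < η) (hδ : 0 < δ)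
    (hp : ∀ j, ‖p j‖ ≤ P) (hb1 : ∀ u, ‖h1 u‖ ≤ B) (hb2 : ∀ u, ‖h2 u‖ ≤ B)
    (w : V → H)
    (hw : ∀ u, w u = ∑ j, softmax βc (fun k => ⟪r u, p k⟫) j • p j)
    (α1 α2 : V → ℝ)
    (hα1 : ∀ u, α1 u = Real.exp (βh * ⟪h1 u, w u⟫) /
        (Real.exp (βh * ⟪h1 u, w u⟫) + Real.exp (βh * ⟪h2 u, w u⟫)))
    (hα2 : ∀ u, α2 u = Real.exp (βh * ⟪h2 u, w u⟫) /
        (Real.exp (βh * ⟪h1 u, w u⟫) + Real.exp (βh * ⟪h2 u, w u⟫)))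
    (h : V → H) (hh : ∀ u, h u = α1 u • h1 u + α2 u • h2 u)
    (hmargin1 : ∀ u, ∀ j, j ≠ z u → ⟪r u, p j⟫ + γ ≤ ⟪r u, p (z u)⟫)
    (hmargin2 : ∀ u, ⟪h1 u, p (z u)⟫ + η ≤ ⟪h2 u, p (z u)⟫)
    (hgap : ∀ u, δ ≤ HNDgap z h2 u)
    (hS : ∀ u : V, (Finset.univ.filter fun v => v ≠ u ∧ z v = z u).Nonempty)
    (hD : ∀ u : V, (Finset.univ.filter fun v => z v ≠ z u).Nonempty)
    (hcond1 : 4 * B * P * ((c : ℝ) - 1) * Real.exp (-(βc * γ)) ≤ η / 2)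
    (hcond2 : 8 * B ^ 2 * Real.exp (-(βh * η / 2)) < δ) :
    ∀ u : V, 0 < HNDgap z h u := by
  have hinner : ∀ u, ⟪h1 u, w u⟫ + η / 2 ≤ ⟪h2 u, w u⟫ := fun u => by
    have hwp : ‖w u - p (z u)‖ ≤ 2 * P * ((c : ℝ) - 1) * Real.exp (-(βc * γ)) := by
      rw [hw u]
      exact norm_sum_softmax_smul_sub_le hβc.le hp (hmargin1 u)
    have hdiff : ‖h2 u - h1 u‖ ≤ 2 * B := by
      linarith [norm_sub_le (h2 u) (h1 u), hb1 u, hb2 u]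
    have hcs := (abs_real_inner_le_norm (h2 u - h1 u) (w u - p (z u))).trans
      (mul_le_mul hdiff hwp (norm_nonneg _) (by positivity))
    have hlow := (abs_le.mp hcs).1
    simp only [inner_sub_left, inner_sub_right] at hlow
    linarith [hmargin2 u]
  have hα1_nonneg : ∀ u, 0 ≤ α1 u := fun u => by rw [hα1 u]; positivity
  have hα2_nonneg : ∀ u, 0 ≤ α2 u := fun u => by rw [hα2 u]; positivity
  have hα_add : ∀ u, α1 u + α2 u = 1 := fun u => by
    rw [hα1 u, hα2 u, ← add_div]
    exact div_self (by positivity)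
  have hα1_le : ∀ u, α1 u ≤ Real.exp (-(βh * η / 2)) := fun u => by
    rw [hα1 u]
    refine exp_div_add_exp_le.trans (Real.exp_le_exp.mpr ?_)
    linarith [mul_le_mul_of_nonneg_left (hinner u) hβh.le]
  have hnorm : ∀ u, ‖h u‖ ≤ B := fun u => by
    rw [hh u]
    exact mem_closedBall_zero_iff.mp (convex_closedBall (0 : H) B
      (mem_closedBall_zero_iff.mpr (hb1 u)) (mem_closedBall_zero_iff.mpr (hb2 u))
      (hα1_nonneg u) (hα2_nonneg u) (hα_add u))
  have hclose : ∀ u, ‖h u - h2 u‖ ≤ Real.exp (-(βh * η / 2)) * (2 * B) := fun u => by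
    have heq : h u - h2 u = α1 u • (h1 u - h2 u) := by
      rw [hh u, eq_sub_of_add_eq' (hα_add u)]
      module
    rw [heq, norm_smul, Real.norm_of_nonneg (hα1_nonneg u)]
    refine mul_le_mul (hα1_le u) ?_ (norm_nonneg _) (Real.exp_pos _).le
    linarith [norm_sub_le (h1 u) (h2 u), hb1 u, hb2 u]
  intro u
  have hstab := HNDgap_sub_le (hS u) (hD u) fun v =>
    abs_inner_sub_inner_le (hnorm u) (hb2 v) (hclose u) (hclose v)
  linarith [hgap u]
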